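/- Let T be a linear map on a C*-algebra A that is triple derivable at orthogonal pairs, and let e ∈ A be a tripotent. Then for all x, y, z ∈ A with P₂(e)(x) = x, P₂(e)(y) = y, P₂(e)(z) = z and x ⊥ y, one has {P₂(e)(T(x)), y, z} + {x, P₂(e)(T(y)), z} + {x, y, P₂(e)(T(z))} = 0; that is, the compression of T to the Peirce 2-space A₂(e) is triple derivable at orthogonal pairs on A₂(e). -/

import Mathlib

variable {A : Type*} [NonUnitalNormedRing A] [StarRing A] [CStarRing A]
  [NormedSpace ℂ A] [IsScalarTower ℂ A A] [SMulCommClass ℂ A A]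
  [StarModule ℂ A] [CompleteSpace A]

/-- The triple product `{x,y,z} = (1/2)(x y* z + z y* x)` on a C*-algebra. -/
noncomputable def tp (x y z : A) : A := (2⁻¹ : ℂ) • (x * star y * z + z * star y * x)

/-- Orthogonality: `a ⊥ b` iff `a b* = 0` and `b* a = 0`. -/
def Orthog (a b : A) : Prop := a * star b = 0 ∧ star b * a = 0

/-- A map is triple derivable at orthogonal pairs. -/
def TripleDerivableAtOrthPairs (T : A → A) : Prop :=
  ∀ a b c : A, Orthog a b →
    tp (T a) b c + tp a (T b) c + tp a b (T c) = 0

/-- The Peirce 2-projection `P₂(e)(x) = e e* x e* e` associated with a tripotent `e`. -/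
def P₂ (e x : A) : A := e * star e * x * star e * e

/-- `P₂ e` is additive and homogeneous, so it commutes with the halved sum in `tp`. -/
theorem P₂_half_add (e u v : A) :
    P₂ e ((2⁻¹ : ℂ) • (u + v)) = (2⁻¹ : ℂ) • (P₂ e u + P₂ e v) := by
  simp only [P₂, mul_smul_comm, smul_mul_assoc, mul_add, add_mul]

theorem P₂_add (e u v : A) : P₂ e (u + v) = P₂ e u + P₂ e v := by
  simp only [P₂, mul_add, add_mul]

theorem P₂_zero (e : A) : P₂ e 0 = 0 := by
  simp only [P₂, mul_zero, zero_mul]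

/-- Elements of the Peirce 2-space absorb the left projection `e e*`. -/
theorem mul_star_mul_of_P₂_eq {e x : A} (he : e * star e * e = e) (hx : P₂ e x = x) :
    e * star e * x = x := by
  conv_lhs => rw [← hx]
  conv_rhs => rw [← hx]
  simp only [P₂, ← mul_assoc, he]

/-- Elements of the Peirce 2-space absorb the right projection `e* e`. -/
theorem mul_mul_star_of_P₂_eq {e x : A} (he : e * star e * e = e) (hx : P₂ e x = x) :
    x * (star e * e) = x := by
  conv_lhs => rw [← hx]
  conv_rhs => rw [← hx]
  simp only [P₂, mul_assoc] at he ⊢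
  rw [he]

theorem star_mul_of_P₂_eq {e x : A} (he : e * star e * e = e) (hx : P₂ e x = x) :
    star x * (e * star e) = star x := by
  simpa only [star_mul, star_star] using congrArg star (mul_star_mul_of_P₂_eq he hx)

theorem mul_star_of_P₂_eq {e x : A} (he : e * star e * e = e) (hx : P₂ e x = x) :
    star e * e * star x = star x := by
  simpa only [star_mul, star_star] using congrArg star (mul_mul_star_of_P₂_eq he hx)

/-- `P₂ e` passes through the outer slot of the triple product on the Peirce 2-space. -/
theorem tp_P₂_left {e y z : A} (he : e * star e * e = e) (hy : P₂ e y = y) (hz : P₂ e z = z)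
    (u : A) : tp (P₂ e u) y z = P₂ e (tp u y z) := by
  have h1 : P₂ e u * star y * z = P₂ e (u * star y * z) := by
    calc P₂ e u * star y * z = e * star e * u * (star e * e * star y) * z := by
          simp only [P₂, mul_assoc]
      _ = e * star e * u * star y * (z * (star e * e)) := by
          rw [mul_star_of_P₂_eq he hy, mul_mul_star_of_P₂_eq he hz]
      _ = _ := by simp only [P₂, mul_assoc]
  have h2 : z * star y * P₂ e u = P₂ e (z * star y * u) := by
    calc z * star y * P₂ e u = z * (star y * (e * star e)) * u * star e * e := by
          simp only [P₂, mul_assoc]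
      _ = e * star e * z * star y * u * star e * e := by
          rw [star_mul_of_P₂_eq he hy, mul_star_mul_of_P₂_eq he hz]
      _ = _ := by simp only [P₂, mul_assoc]
  simp only [tp, P₂_half_add, h1, h2]

theorem tp_comm (x y z : A) : tp x y z = tp z y x := by
  rw [tp, tp, add_comm]

/-- `P₂ e` passes through the middle slot of the triple product on the Peirce 2-space. -/
theorem tp_P₂_middle {e x z : A} (he : e * star e * e = e) (hx : P₂ e x = x) (hz : P₂ e z = z)
    (u : A) : tp x (P₂ e u) z = P₂ e (tp x u z) := by
  have key : ∀ {v w : A}, P₂ e v = v → P₂ e w = w →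
      v * star (P₂ e u) * w = P₂ e (v * star u * w) := by
    intro v w hv hw
    calc v * star (P₂ e u) * w = v * (star e * e) * star u * (e * star e * w) := by
          simp only [P₂, star_mul, star_star, mul_assoc]
      _ = e * star e * v * star u * (w * (star e * e)) := by
          rw [mul_star_mul_of_P₂_eq he hv, mul_mul_star_of_P₂_eq he hv,
            mul_star_mul_of_P₂_eq he hw, mul_mul_star_of_P₂_eq he hw]
      _ = _ := by simp only [P₂, mul_assoc]
  simp only [tp, P₂_half_add, key hx hz, key hz hx]

/-- the compression to the Peirce 2-space of a tripotent of a linear map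
triple derivable at orthogonal pairs is triple derivable at orthogonal pairs on that
Peirce 2-space. -/
theorem stmt10 (T : A →ₗ[ℂ] A)
    (hT : TripleDerivableAtOrthPairs (T : A → A))
    (e : A) (he : e * star e * e = e) :
    ∀ x y z : A, P₂ e x = x → P₂ e y = y → P₂ e z = z → Orthog x y →
      tp (P₂ e (T x)) y z + tp x (P₂ e (T y)) z + tp x y (P₂ e (T z)) = 0 := by
  intro x y z hx hy hz hxy
  rw [tp_P₂_left he hy hz, tp_P₂_middle he hx hz, tp_comm x y (P₂ e (T z)),
    tp_P₂_left he hy hx, tp_comm (T z) y x, ← P₂_add, ← P₂_add, hT x y z hxy, P₂_zero]
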